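/- Assume additionally that r(t) ≥ 0 for all t ≥ 0. Then, by Slepian's inequality applied to {X(t)} and the process built from independent copies of X on consecutive unit intervals, for every u ∈ ℝ and every t > 0, P(sup_{s ∈ [0,t]} X(s) ≤ u) ≥ (P(sup_{s ∈ [0,1]} X(s) ≤ u))^{⌊t⌋ + 1}. -/

import Mathlib

open MeasureTheory ProbabilityTheory Filter Set Topology

structure Good {n : ℕ} (C : ℝ) (F : (Fin n → ℝ) → ℝ) (D : Fin n → (Fin n → ℝ) → ℝ) : Prop where
  meas : Measurable F
  measD : ∀ i, Measurable (D i)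
  nonneg : ∀ x, 0 ≤ F x
  le_one : ∀ x, F x ≤ 1
  D_nonpos : ∀ i x, D i x ≤ 0
  D_bound : ∀ i x, -C ≤ D i x
  taylor : ∀ x h, |F (x + h) - F x - ∑ i, D i x * h i| ≤ C * ‖h‖ ^ 2

lemma Good.C_nonneg {n : ℕ} {C : ℝ} {F : (Fin n → ℝ) → ℝ} {D} (hF : Good C F D) (i : Fin n) : 0 ≤ C := by
  have := hF.D_nonpos i 0
  have := hF.D_bound i 0
  linarith

lemma Good.lin_bound {n : ℕ} {C : ℝ} (hC : 0 ≤ C) {F : (Fin n → ℝ) → ℝ} {D} (hF : Good C F D)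
    (x h : Fin n → ℝ) : |∑ i, D i x * h i| ≤ (n * C) * ‖h‖ := by
  calc |∑ i, D i x * h i| ≤ ∑ i, |D i x * h i| := Finset.abs_sum_le_sum_abs _ _
    _ ≤ ∑ i : Fin n, C * ‖h‖ := by
        apply Finset.sum_le_sum
        intro i _
        rw [abs_mul]
        apply mul_le_mul _ (norm_le_pi_norm h i) (abs_nonneg _) hC
        rw [abs_le]
        exact ⟨hF.D_bound i x, (hF.D_nonpos i x).trans hC⟩
    _ = _ := by simp; ring

lemma integrable_of_bdd {α : Type*} [MeasurableSpace α] {μ : Measure α} [IsProbabilityMeasure μ] {f : α → ℝ}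
    (hf : Measurable f) (C : ℝ) (h : ∀ x, |f x| ≤ C) : Integrable f μ :=
  Integrable.of_bound hf.aestronglyMeasurable C (Eventually.of_forall h)

section
variable {n : ℕ} {μ : Measure (Fin n → ℝ)} [IsProbabilityMeasure μ]

lemma Good.int {C : ℝ} {F : (Fin n → ℝ) → ℝ} {D} (hF : Good C F D) (s : ℝ) (x : Fin n → ℝ) :
    Integrable (fun y => F (x + s • y)) μ := by
  apply integrable_of_bdd (hF.meas.comp (by fun_prop)) 1
  intro y
  rw [Function.comp_apply, abs_le]; constructor <;> linarith [hF.nonneg (x + s • y), hF.le_one (x + s • y)]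

lemma Good.intD {C : ℝ} {F : (Fin n → ℝ) → ℝ} {D} (hF : Good C F D) (s : ℝ) (x : Fin n → ℝ) (i) :
    Integrable (fun y => D i (x + s • y)) μ := by
  apply integrable_of_bdd ((hF.measD i).comp (by fun_prop)) C
  intro y
  have := hF.C_nonneg i
  rw [Function.comp_apply, abs_le]; constructor <;> linarith [hF.D_nonpos i (x + s • y), hF.D_bound i (x + s • y)]

lemma Good.conv {C : ℝ} {F : (Fin n → ℝ) → ℝ} {D} (hF : Good C F D) (s : ℝ) :
    Good C (fun x => ∫ y, F (x + s • y) ∂μ) (fun i x => ∫ y, D i (x + s • y) ∂μ) where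
  meas := by
    have : Measurable (fun p : (Fin n → ℝ) × (Fin n → ℝ) => F (p.1 + s • p.2)) :=
      hF.meas.comp (by fun_prop)
    exact (this.stronglyMeasurable.integral_prod_right (ν := μ)).measurable
  measD := by
    intro i
    have : Measurable (fun p : (Fin n → ℝ) × (Fin n → ℝ) => D i (p.1 + s • p.2)) :=
      (hF.measD i).comp (by fun_prop)
    exact (this.stronglyMeasurable.integral_prod_right (ν := μ)).measurable
  nonneg := fun x => integral_nonneg fun y => hF.nonneg _
  le_one := fun x => by
    calc ∫ y, F (x + s • y) ∂μ ≤ ∫ y, 1 ∂μ := integral_mono (hF.int s x) (integrable_const _) fun y => hF.le_one _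
      _ = 1 := by simp
  D_nonpos := fun i x => integral_nonpos fun y => hF.D_nonpos i _
  D_bound := fun i x => by
    calc -C = ∫ y, -C ∂μ := by simp
      _ ≤ _ := integral_mono (integrable_const _) (hF.intD s x i) fun y => hF.D_bound i _
  taylor := fun x h => by
    have e : (∫ y, F (x + h + s • y) ∂μ) - (∫ y, F (x + s • y) ∂μ) - ∑ i, (∫ y, D i (x + s • y) ∂μ) * h i
        = ∫ y, (F (x + s • y + h) - F (x + s • y) - ∑ i, D i (x + s • y) * h i) ∂μ := by
      have e1 : ∀ y, x + s • y + h = x + h + s • y := fun y => by abel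
      simp_rw [e1]
      rw [integral_sub, integral_sub (hF.int _ _) (hF.int _ _), integral_finsetSum]
      · simp_rw [integral_mul_const]
      · intro i _; exact (hF.intD _ _ _).mul_const _
      · exact (hF.int _ _).sub (hF.int _ _)
      · exact integrable_finsetSum _ fun i _ => (hF.intD _ _ _).mul_const _
    rw [e]
    have := norm_integral_le_of_norm_le_const (μ := μ) (C := C * ‖h‖^2)
      (f := fun y => (F (x + s • y + h) - F (x + s • y) - ∑ i, D i (x + s • y) * h i))
      (Eventually.of_forall fun y => hF.taylor _ _)
    simpa using this

/-- one step -/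
lemma step {C : ℝ} (hC : 0 ≤ C) (hmom : ∀ k : ℕ, k ≤ 4 → Integrable (fun y : Fin n → ℝ => ‖y‖ ^ k) μ)
    (hmean : ∀ i, ∫ y, y i ∂μ = 0) (hcov : ∀ i j, 0 ≤ ∫ y, y i * y j ∂μ) :
    ∃ K : ℝ, ∀ F G D D', Good C F D → Good C G D' → ∀ s : ℝ, 0 ≤ s → s ≤ 1 → ∀ x : Fin n → ℝ,
      (∫ y, F (x + s • y) ∂μ) * (∫ y, G (x + s • y) ∂μ) - K * s ^ 3
        ≤ ∫ y, F (x + s • y) * G (x + s • y) ∂μ := by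
  set m2 := ∫ y, ‖y‖ ^ 2 ∂μ with hm2
  set m3 := ∫ y, ‖y‖ ^ 3 ∂μ with hm3
  set m4 := ∫ y, ‖y‖ ^ 4 ∂μ with hm4
  have m2n : 0 ≤ m2 := integral_nonneg fun y => by positivity
  have m3n : 0 ≤ m3 := integral_nonneg fun y => by positivity
  have m4n : 0 ≤ m4 := integral_nonneg fun y => by positivity
  refine ⟨2 * (n * C) * C * m3 + C ^ 2 * m4 + C ^ 2 * m2 ^ 2, ?_⟩
  intro F G D D' hF hG s hs0 hs1 x
  have iF := hF.int (μ := μ) s x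
  have iG := hG.int (μ := μ) s x
  have iFG : Integrable (fun y => F (x + s • y) * G (x + s • y)) μ := by
    apply integrable_of_bdd ((hF.meas.comp (by fun_prop)).mul (hG.meas.comp (by fun_prop))) 1
    intro y
    rw [Pi.mul_apply, Function.comp_apply, Function.comp_apply, abs_mul, abs_of_nonneg (hF.nonneg _), abs_of_nonneg (hG.nonneg _)]
    exact mul_le_one₀ (hF.le_one _) (hG.nonneg _) (hG.le_one _)
  have icoord : ∀ i, Integrable (fun y : Fin n → ℝ => y i) μ := fun i => by
    apply (hmom 1 (by norm_num)).mono' (Measurable.aestronglyMeasurable (by fun_prop))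
    exact Eventually.of_forall fun y => by simpa using norm_le_pi_norm y i
  have icc : ∀ i j, Integrable (fun y : Fin n → ℝ => y i * y j) μ := fun i j => by
    apply (hmom 2 (by norm_num)).mono' (Measurable.aestronglyMeasurable (by fun_prop))
    refine Eventually.of_forall fun y => ?_
    rw [norm_mul, sq]
    exact mul_le_mul (norm_le_pi_norm y i) (norm_le_pi_norm y j) (norm_nonneg _) (norm_nonneg _)
  -- first-order means
  have mean : ∀ (F : (Fin n → ℝ) → ℝ) D, Good C F D → |(∫ y, F (x + s • y) ∂μ) - F x| ≤ C * s ^ 2 * m2 := by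
    intro F D hF
    have e : (∫ y, F (x + s • y) ∂μ) - F x = ∫ y, (F (x + s • y) - F x - ∑ i, D i x * (s • y) i) ∂μ := by
      rw [integral_sub, integral_sub (hF.int _ _) (integrable_const _), integral_finsetSum]
      · have : ∀ i, ∫ y : Fin n → ℝ, D i x * (s • y) i ∂μ = 0 := fun i => by
          simp [integral_const_mul, hmean]
        rw [Finset.sum_eq_zero fun i _ => this i]; simp
      · intro i _
        exact ((icoord i).const_mul s).const_mul _
      · exact (hF.int _ _).sub (integrable_const _)
      · exact integrable_finsetSum _ fun i _ => ((icoord i).const_mul s).const_mul _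
    rw [e]
    have h2 : Integrable (fun y : Fin n → ℝ => C * s ^ 2 * ‖y‖ ^ 2) μ := (hmom 2 (by norm_num)).const_mul _
    have := norm_integral_le_of_norm_le (μ := μ) h2
      (f := fun y => (F (x + s • y) - F x - ∑ i, D i x * (s • y) i))
      (Eventually.of_forall fun y => by
        refine (hF.taylor x (s • y)).trans (le_of_eq ?_)
        rw [norm_smul, Real.norm_of_nonneg hs0]; ring)
    rw [integral_const_mul] at this
    exact this
  have mF := mean F D hF
  have mG := mean G D' hG
  set A : (Fin n → ℝ) → ℝ := fun y => ∑ i, D i x * y i with hA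
  set B : (Fin n → ℝ) → ℝ := fun y => ∑ i, D' i x * y i with hB
  have hABe : ∀ y, A y * B y = ∑ i, ∑ j, (D i x * D' j x) * (y i * y j) := by
    intro y
    rw [hA, hB]; simp only
    rw [Finset.sum_mul_sum]
    refine Finset.sum_congr rfl fun i _ => Finset.sum_congr rfl fun j _ => by ring
  have iAB : Integrable (fun y => A y * B y) μ := by
    simp_rw [hABe]
    exact integrable_finsetSum _ fun i _ => integrable_finsetSum _ fun j _ => (icc i j).const_mul _
  have pAB : 0 ≤ ∫ y, A y * B y ∂μ := by
    simp_rw [hABe]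
    rw [integral_finsetSum _ fun i _ => integrable_finsetSum _ fun j _ => (icc i j).const_mul _]
    refine Finset.sum_nonneg fun i _ => ?_
    rw [integral_finsetSum _ fun j _ => (icc i j).const_mul _]
    refine Finset.sum_nonneg fun j _ => ?_
    rw [integral_const_mul]
    exact mul_nonneg (mul_nonneg_of_nonpos_of_nonpos (hF.D_nonpos i x) (hG.D_nonpos j x)) (hcov i j)
  have pw : ∀ y, s ^ 2 * (A y * B y) - (2 * (n * C) * C * s ^ 3 * ‖y‖ ^ 3 + C ^ 2 * s ^ 4 * ‖y‖ ^ 4)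
      ≤ (F (x + s • y) - F x) * (G (x + s • y) - G x) := by
    intro y
    have tF := hF.taylor x (s • y)
    have tG := hG.taylor x (s • y)
    have lF := hF.lin_bound hC x y
    have lG := hG.lin_bound hC x y
    have eA : ∑ i, D i x * (s • y) i = s * A y := by
      rw [hA]; simp only [Pi.smul_apply, smul_eq_mul, Finset.mul_sum]
      exact Finset.sum_congr rfl fun i _ => by ring
    have eB : ∑ i, D' i x * (s • y) i = s * B y := by
      rw [hB]; simp only [Pi.smul_apply, smul_eq_mul, Finset.mul_sum]
      exact Finset.sum_congr rfl fun i _ => by ring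
    rw [eA, norm_smul, Real.norm_of_nonneg hs0] at tF
    rw [eB, norm_smul, Real.norm_of_nonneg hs0] at tG
    change |A y| ≤ _ at lF
    change |B y| ≤ _ at lG
    set f := F (x + s • y) - F x
    set g := G (x + s • y) - G x
    set R := f - s * A y with hR
    set S := g - s * B y with hS
    have ef : f = s * A y + R := by rw [hR]; ring
    have eg : g = s * B y + S := by rw [hS]; ring
    rw [ef, eg]
    set N := ‖y‖
    have hN : 0 ≤ N := norm_nonneg _
    have b1 : |A y * S| ≤ (n * C * N) * (C * (s * N) ^ 2) := by
      rw [abs_mul]; exact mul_le_mul lF tG (abs_nonneg _) (by positivity)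
    have b2 : |R * B y| ≤ (C * (s * N) ^ 2) * (n * C * N) := by
      rw [abs_mul]; exact mul_le_mul tF lG (abs_nonneg _) (by positivity)
    have b3 : |R * S| ≤ (C * (s * N) ^ 2) * (C * (s * N) ^ 2) := by
      rw [abs_mul]; exact mul_le_mul tF tG (abs_nonneg _) (by positivity)
    have c1 := mul_le_mul_of_nonneg_left (abs_le.1 b1).1 hs0
    have c2 := mul_le_mul_of_nonneg_left (abs_le.1 b2).1 hs0
    have c3 := (abs_le.1 b3).1
    nlinarith
  have i3 := hmom 3 (by norm_num)
  have i4 := hmom 4 (by norm_num)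
  have big : s ^ 2 * (∫ y, A y * B y ∂μ) - (2 * (n * C) * C * s ^ 3 * m3 + C ^ 2 * s ^ 4 * m4)
      ≤ ∫ y, (F (x + s • y) - F x) * (G (x + s • y) - G x) ∂μ := by
    have e : s ^ 2 * (∫ y, A y * B y ∂μ) - (2 * (n * C) * C * s ^ 3 * m3 + C ^ 2 * s ^ 4 * m4)
      = ∫ y, (s ^ 2 * (A y * B y) - (2 * (n * C) * C * s ^ 3 * ‖y‖ ^ 3 + C ^ 2 * s ^ 4 * ‖y‖ ^ 4)) ∂μ := by
      have j3 : Integrable (fun y : Fin n → ℝ => 2 * (n * C) * C * s ^ 3 * ‖y‖ ^ 3) μ := i3.const_mul _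
      have j4 : Integrable (fun y : Fin n → ℝ => C ^ 2 * s ^ 4 * ‖y‖ ^ 4) μ := i4.const_mul _
      have j34 : Integrable (fun y : Fin n → ℝ => 2 * (n * C) * C * s ^ 3 * ‖y‖ ^ 3
        + C ^ 2 * s ^ 4 * ‖y‖ ^ 4) μ := j3.add j4
      rw [integral_sub (iAB.const_mul _) j34,
        integral_add j3 j4, integral_const_mul, integral_const_mul,
        integral_const_mul]
    rw [e]
    refine integral_mono ((iAB.const_mul _).sub ((i3.const_mul _).add (i4.const_mul _))) ?_ pw
    have : (fun y => (F (x + s • y) - F x) * (G (x + s • y) - G x)) =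
      fun y => F (x + s • y) * G (x + s • y) - F (x + s • y) * G x - F x * G (x + s • y) + F x * G x := by
      ext y; ring
    rw [this]
    exact ((iFG.sub (iF.mul_const _)).sub (iG.const_mul _)).add (integrable_const _)
  have ex : ∫ y, (F (x + s • y) - F x) * (G (x + s • y) - G x) ∂μ =
      (∫ y, F (x + s • y) * G (x + s • y) ∂μ) - (∫ y, F (x + s • y) ∂μ) * G x
        - F x * (∫ y, G (x + s • y) ∂μ) + F x * G x := by
    have : (fun y => (F (x + s • y) - F x) * (G (x + s • y) - G x)) =
      fun y => F (x + s • y) * G (x + s • y) - F (x + s • y) * G x - F x * G (x + s • y) + F x * G x := by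
      ext y; ring
    have k1 : Integrable (fun y => F (x + s • y) * G (x + s • y) - F (x + s • y) * G x) μ :=
      iFG.sub (iF.mul_const _)
    have k2 : Integrable (fun y => F (x + s • y) * G (x + s • y) - F (x + s • y) * G x
      - F x * G (x + s • y)) μ := k1.sub (iG.const_mul _)
    rw [this, integral_add k2 (integrable_const _),
      integral_sub k1 (iG.const_mul _), integral_sub iFG (iF.mul_const _),
      integral_mul_const, integral_const_mul]
    simp
  rw [ex] at big
  set a := ∫ y, F (x + s • y) ∂μ
  set b := ∫ y, G (x + s • y) ∂μ
  have hab : |(a - F x) * (b - G x)| ≤ (C * s ^ 2 * m2) * (C * s ^ 2 * m2) := by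
    rw [abs_mul]; exact mul_le_mul mF mG (abs_nonneg _) (by positivity)
  have hab' := (abs_le.1 hab).2
  have s4 : s ^ 4 ≤ s ^ 3 := pow_le_pow_of_le_one hs0 hs1 (by norm_num)
  have d1 : C ^ 2 * m4 * s ^ 4 ≤ C ^ 2 * m4 * s ^ 3 := mul_le_mul_of_nonneg_left s4 (by positivity)
  have d2 : C ^ 2 * m2 ^ 2 * s ^ 4 ≤ C ^ 2 * m2 ^ 2 * s ^ 3 := mul_le_mul_of_nonneg_left s4 (by positivity)
  have d3 : 0 ≤ s ^ 2 * ∫ y, A y * B y ∂μ := mul_nonneg (by positivity) pAB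
  nlinarith

lemma iter {C K : ℝ}
    (hstab : ∀ a b : ℝ, (μ.map (a • ·)) ∗ (μ.map (b • ·)) = μ.map (√(a ^ 2 + b ^ 2) • ·))
    (s : ℝ) (hs : 0 ≤ s)
    (hstep : ∀ F G D D', Good C F D → Good C G D' → ∀ x : Fin n → ℝ,
      (∫ y, F (x + s • y) ∂μ) * (∫ y, G (x + s • y) ∂μ) - K * s ^ 3
        ≤ ∫ y, F (x + s • y) * G (x + s • y) ∂μ) (k : ℕ) :
    ∀ F G D D', Good C F D → Good C G D' → ∀ x : Fin n → ℝ,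
      (∫ y, F (x + (√k * s) • y) ∂μ) * (∫ y, G (x + (√k * s) • y) ∂μ) - k * (K * s ^ 3)
        ≤ ∫ y, F (x + (√k * s) • y) * G (x + (√k * s) • y) ∂μ := by
  have key : ∀ (k : ℕ) (H : (Fin n → ℝ) → ℝ), Measurable H → (∀ x, |H x| ≤ 1) → ∀ x,
      ∫ y, H (x + (√(k + 1 : ℕ) * s) • y) ∂μ = ∫ z, ∫ y, H (x + (√k * s) • z + s • y) ∂μ ∂μ := by
    intro k H hH hb x
    have h1 := hstab (√k * s) s
    have e : √((√k * s) ^ 2 + s ^ 2) = √(k + 1 : ℕ) * s := by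
      rw [mul_pow, Real.sq_sqrt (by positivity)]
      have : (k : ℝ) * s ^ 2 + s ^ 2 = (k + 1 : ℕ) * s ^ 2 := by push_cast; ring
      rw [this, Real.sqrt_mul (by positivity), Real.sqrt_sq hs]
    rw [e] at h1
    have h2 : ∫ y, H (x + (√(k + 1 : ℕ) * s) • y) ∂μ = ∫ w, H (x + w) ∂(μ.map ((√(k + 1 : ℕ) * s) • ·)) := by
      have hm : Measurable fun w => H (x + w) := hH.comp (by fun_prop)
      rw [integral_map (by fun_prop) hm.aestronglyMeasurable]
    have : ∀ a : ℝ, IsProbabilityMeasure (μ.map (a • ·)) := fun a =>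
      Measure.isProbabilityMeasure_map (by fun_prop)
    rw [h2, ← h1, integral_conv]
    · rw [integral_map (by fun_prop)]
      · refine integral_congr_ae (Eventually.of_forall fun z => ?_)
        simp only
        have hm : Measurable fun y => H (x + ((√k * s) • z + y)) := hH.comp (by fun_prop)
        rw [integral_map (by fun_prop) hm.aestronglyMeasurable]
        simp_rw [add_assoc]
      · have : Measurable (fun p : (Fin n → ℝ) × (Fin n → ℝ) => H (x + (p.1 + p.2))) :=
          hH.comp (by fun_prop)
        exact (this.stronglyMeasurable.integral_prod_right).aestronglyMeasurable
    · exact integrable_of_bdd (hH.comp (by fun_prop)) 1 fun _ => hb _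
  have ab : ∀ {F : (Fin n → ℝ) → ℝ} {D}, Good C F D → ∀ x, |F x| ≤ 1 := fun {F D} hF x => by
    rw [abs_of_nonneg (hF.nonneg x)]; exact hF.le_one x
  induction k with
  | zero =>
    intro F G D D' hF hG x
    simp
  | succ k ih =>
    intro F G D D' hF hG x
    have habFG : ∀ x, |F x * G x| ≤ 1 := fun x => by
      rw [abs_mul]; exact mul_le_one₀ (ab hF x) (abs_nonneg _) (ab hG x)
    have mFG : Measurable fun x => F x * G x := hF.meas.mul hG.meas
    rw [key k F hF.meas (ab hF), key k G hG.meas (ab hG), key k (fun x => F x * G x) mFG habFG]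
    have h1 := ih _ _ _ _ (hF.conv (μ := μ) s) (hG.conv (μ := μ) s) x
    have gF := hF.conv (μ := μ) s
    have gG := hG.conv (μ := μ) s
    have i1 : Integrable (fun z => (∫ y, F (x + (√k * s) • z + s • y) ∂μ) *
        ∫ y, G (x + (√k * s) • z + s • y) ∂μ) μ := by
      apply integrable_of_bdd ((gF.meas.comp (by fun_prop : Measurable fun z => x + (√k * s) • z)).mul
        (gG.meas.comp (by fun_prop : Measurable fun z => x + (√k * s) • z))) 1
      intro z
      rw [Pi.mul_apply, abs_mul]
      exact mul_le_one₀ (ab gF _) (abs_nonneg _) (ab gG _)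
    have i2 : Integrable (fun z => ∫ y, F (x + (√k * s) • z + s • y) * G (x + (√k * s) • z + s • y) ∂μ) μ := by
      have : Measurable (fun p : (Fin n → ℝ) × (Fin n → ℝ) =>
          F (x + (√k * s) • p.1 + s • p.2) * G (x + (√k * s) • p.1 + s • p.2)) :=
        mFG.comp (by fun_prop : Measurable fun p : (Fin n → ℝ) × (Fin n → ℝ) => x + (√k * s) • p.1 + s • p.2)
      apply integrable_of_bdd (this.stronglyMeasurable.integral_prod_right).measurable 1
      intro z
      have := norm_integral_le_of_norm_le_const (μ := μ) (C := 1)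
        (f := fun y => F (x + (√k * s) • z + s • y) * G (x + (√k * s) • z + s • y))
        (Eventually.of_forall fun y => habFG _)
      simpa using this
    have h2 := integral_mono (i1.sub (integrable_const (K * s ^ 3))) i2
      fun z => hstep F G D D' hF hG (x + (√k * s) • z)
    rw [integral_sub' i1 (integrable_const _)] at h2
    simp only [integral_const, probReal_univ, one_smul] at h2
    push_cast
    linarith

lemma assoc {C : ℝ} (hC : 0 ≤ C) (hmom : ∀ k : ℕ, k ≤ 4 → Integrable (fun y : Fin n → ℝ => ‖y‖ ^ k) μ)
    (hmean : ∀ i, ∫ y, y i ∂μ = 0) (hcov : ∀ i j, 0 ≤ ∫ y, y i * y j ∂μ)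
    (hstab : ∀ a b : ℝ, (μ.map (a • ·)) ∗ (μ.map (b • ·)) = μ.map (√(a ^ 2 + b ^ 2) • ·))
    {F G : (Fin n → ℝ) → ℝ} {D D'} (hF : Good C F D) (hG : Good C G D') :
    (∫ y, F y ∂μ) * (∫ y, G y ∂μ) ≤ ∫ y, F y * G y ∂μ := by
  obtain ⟨K, hK⟩ := step (μ := μ) hC hmom hmean hcov
  have h : ∀ N : ℕ, (∫ y, F y ∂μ) * (∫ y, G y ∂μ) - K * (1 / √(N + 1 : ℕ)) ≤ ∫ y, F y * G y ∂μ := by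
    intro N
    have hp : 1 ≤ √((N + 1 : ℕ) : ℝ) := by
      rw [Real.one_le_sqrt]; push_cast; linarith [(Nat.cast_nonneg N : (0:ℝ) ≤ N)]
    have hp0 : 0 < √((N + 1 : ℕ) : ℝ) := by linarith
    have := iter (μ := μ) (C := C) (K := K) hstab (1 / √(N + 1 : ℕ)) (by positivity)
      (fun F G D D' hF hG x => hK F G D D' hF hG _ (by positivity) (by rw [div_le_one hp0]; exact hp) x)
      (N + 1) F G D D' hF hG 0
    rw [mul_one_div_cancel hp0.ne'] at this
    simp only [zero_add, one_smul] at this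
    convert this using 2
    have e : ((N + 1 : ℕ) : ℝ) = √((N + 1 : ℕ) : ℝ) ^ 2 := (Real.sq_sqrt (by positivity)).symm
    set q := √((N + 1 : ℕ) : ℝ)
    rw [e]; field_simp
  have lim : Tendsto (fun N : ℕ => (∫ y, F y ∂μ) * (∫ y, G y ∂μ) - K * (1 / √(N + 1 : ℕ))) atTop
      (𝓝 ((∫ y, F y ∂μ) * (∫ y, G y ∂μ) - K * 0)) := by
    refine tendsto_const_nhds.sub (tendsto_const_nhds.mul ?_)
    have h1 : Tendsto (fun N : ℕ => √((N + 1 : ℕ) : ℝ)) atTop atTop :=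
      Real.tendsto_sqrt_atTop.comp (tendsto_natCast_atTop_atTop.comp (tendsto_add_atTop_nat 1))
    simp_rw [one_div]
    exact h1.inv_tendsto_atTop
  rw [mul_zero, sub_zero] at lim
  exact le_of_tendsto' lim h
end


lemma Good.mono {n : ℕ} {C C' : ℝ} {F : (Fin n → ℝ) → ℝ} {D} (hF : Good C F D) (h : C ≤ C') : Good C' F D where
  meas := hF.meas
  measD := hF.measD
  nonneg := hF.nonneg
  le_one := hF.le_one
  D_nonpos := hF.D_nonpos
  D_bound := fun i x => by linarith [hF.D_bound i x]
  taylor := fun x k => (hF.taylor x k).trans (mul_le_mul_of_nonneg_right h (by positivity))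

lemma Good.mul {n : ℕ} {C C' L : ℝ} (hC : 0 ≤ C) (hC' : 0 ≤ C') (hL : 0 ≤ L) {F G : (Fin n → ℝ) → ℝ} {D D'}
    (hF : Good C F D) (hG : Good C' G D')
    (hl : ∀ x h, |F (x + h) - F x| ≤ L * ‖h‖) :
    Good (C + C' + L * (n * C')) (fun x => F x * G x) (fun i x => D i x * G x + F x * D' i x) where
  meas := hF.meas.mul hG.meas
  measD := fun i => ((hF.measD i).mul hG.meas).add (hF.meas.mul (hG.measD i))
  nonneg := fun x => mul_nonneg (hF.nonneg x) (hG.nonneg x)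
  le_one := fun x => mul_le_one₀ (hF.le_one _) (hG.nonneg _) (hG.le_one _)
  D_nonpos := fun i x => add_nonpos (mul_nonpos_of_nonpos_of_nonneg (hF.D_nonpos i x) (hG.nonneg x))
    (mul_nonpos_of_nonneg_of_nonpos (hF.nonneg x) (hG.D_nonpos i x))
  D_bound := fun i x => by
    have h1 : -C ≤ D i x * G x := by
      nlinarith [hF.D_bound i x, hF.D_nonpos i x, hG.nonneg x, hG.le_one x]
    have h2 : -C' ≤ F x * D' i x := by
      nlinarith [hG.D_bound i x, hG.D_nonpos i x, hF.nonneg x, hF.le_one x]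
    have : 0 ≤ L * (n * C') := by positivity
    linarith
  taylor := fun x h => by
    have e : F (x + h) * G (x + h) - F x * G x - ∑ i, (D i x * G x + F x * D' i x) * h i
      = F (x + h) * (G (x + h) - G x - ∑ i, D' i x * h i) + (F (x + h) - F x) * (∑ i, D' i x * h i)
        + G x * (F (x + h) - F x - ∑ i, D i x * h i) := by
      have : ∑ i, (D i x * G x + F x * D' i x) * h i = G x * (∑ i, D i x * h i) + F x * ∑ i, D' i x * h i := by
        rw [Finset.mul_sum, Finset.mul_sum, ← Finset.sum_add_distrib]
        exact Finset.sum_congr rfl fun i _ => by ring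
      rw [this]; ring
    rw [e]
    have t1 : |F (x + h) * (G (x + h) - G x - ∑ i, D' i x * h i)| ≤ 1 * (C' * ‖h‖ ^ 2) := by
      rw [abs_mul, abs_of_nonneg (hF.nonneg _)]
      exact mul_le_mul (hF.le_one _) (hG.taylor x h) (abs_nonneg _) zero_le_one
    have t2 : |(F (x + h) - F x) * (∑ i, D' i x * h i)| ≤ (L * ‖h‖) * (n * C' * ‖h‖) := by
      rw [abs_mul]
      exact mul_le_mul (hl x h) (hG.lin_bound hC' x h) (abs_nonneg _) (by positivity)
    have t3 : |G x * (F (x + h) - F x - ∑ i, D i x * h i)| ≤ 1 * (C * ‖h‖ ^ 2) := by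
      rw [abs_mul, abs_of_nonneg (hG.nonneg _)]
      exact mul_le_mul (hG.le_one _) (hF.taylor x h) (abs_nonneg _) zero_le_one
    refine ((abs_add_le _ _).trans (add_le_add_left (abs_add_le _ _) _)).trans ?_
    nlinarith

/-- base profile -/
noncomputable def psi (x : ℝ) : ℝ := 1 / (1 + (max x 0) ^ 2)
noncomputable def dpsi (x : ℝ) : ℝ := -(2 * max x 0) / (1 + (max x 0) ^ 2) ^ 2

lemma psi_meas : Measurable psi := by unfold psi; fun_prop
lemma dpsi_meas : Measurable dpsi := by unfold dpsi; fun_prop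
lemma psi_nonneg (x : ℝ) : 0 ≤ psi x := by unfold psi; positivity
lemma psi_le_one (x : ℝ) : psi x ≤ 1 := by
  unfold psi; rw [div_le_one (by positivity)]; nlinarith [sq_nonneg (max x 0)]
lemma dpsi_nonpos (x : ℝ) : dpsi x ≤ 0 := by
  unfold dpsi
  apply div_nonpos_of_nonpos_of_nonneg
  · have := le_max_right x 0; linarith
  · positivity
lemma dpsi_bound (x : ℝ) : -1 ≤ dpsi x := by
  unfold dpsi
  rw [le_div_iff₀ (by positivity)]
  set p := max x 0
  nlinarith [sq_nonneg (p - 1), sq_nonneg (p ^ 2), sq_nonneg p]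
lemma max_diff (x k : ℝ) : |max (x + k) 0 - max x 0| ≤ |k| := by
  simpa using abs_max_sub_max_le_abs (x + k) x 0
lemma psi_lip (x k : ℝ) : |psi (x + k) - psi x| ≤ |k| := by
  have h := max_diff x k
  unfold psi
  have hp := le_max_right x 0
  have hq := le_max_right (x + k) 0
  set p := max x 0
  set q := max (x + k) 0
  have e : 1 / (1 + q ^ 2) - 1 / (1 + p ^ 2) = -((q - p) * (p + q)) / ((1 + q ^ 2) * (1 + p ^ 2)) := by
    field_simp; ring
  rw [e, abs_div, abs_neg, abs_mul, abs_of_nonneg (add_nonneg hp hq),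
    abs_of_nonneg (by positivity : 0 ≤ (1 + q ^ 2) * (1 + p ^ 2)), div_le_iff₀ (by positivity)]
  refine mul_le_mul h ?_ (by positivity) (abs_nonneg _)
  nlinarith [sq_nonneg (p - 1), sq_nonneg (q - 1), sq_nonneg (p * q), sq_nonneg p, sq_nonneg q]
lemma psi_taylor (x k : ℝ) : |psi (x + k) - psi x - dpsi x * k| ≤ 4 * k ^ 2 := by
  have h := max_diff x k
  have he : |(max (x + k) 0) ^ 2 - (max x 0) ^ 2 - 2 * max x 0 * k| ≤ k ^ 2 := by
    rw [abs_le]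
    rcases le_total x 0 with hx | hx <;> rcases le_total (x + k) 0 with hk | hk <;>
      simp only [hx, hk, max_eq_left, max_eq_right] <;> constructor <;> nlinarith
  unfold psi dpsi
  have hp := le_max_right x 0
  have hq := le_max_right (x + k) 0
  set p := max x 0
  set q := max (x + k) 0
  set e := q ^ 2 - p ^ 2 - 2 * p * k with hee
  have e1 : 1 / (1 + q ^ 2) - 1 / (1 + p ^ 2) - -(2 * p) / (1 + p ^ 2) ^ 2 * k
     = (-e * (1 + p ^ 2) + 2 * p * (k * (q - p)) * (p + q)) / ((1 + p ^ 2) ^ 2 * (1 + q ^ 2)) := by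
    rw [hee]; field_simp; ring
  rw [e1, abs_div, abs_of_nonneg (by positivity : 0 ≤ (1 + p ^ 2) ^ 2 * (1 + q ^ 2)), div_le_iff₀ (by positivity)]
  have b1 : |-e * (1 + p ^ 2)| ≤ k ^ 2 * (1 + p ^ 2) := by
    rw [abs_mul, abs_neg, abs_of_nonneg (by positivity : 0 ≤ 1 + p ^ 2)]
    exact mul_le_mul_of_nonneg_right he (by positivity)
  have b2 : |k * (q - p)| ≤ k ^ 2 := by
    rw [abs_mul, ← sq_abs k, sq]; exact mul_le_mul_of_nonneg_left h (abs_nonneg _)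
  have b3 : |2 * p * (k * (q - p)) * (p + q)| ≤ k ^ 2 * (2 * p * (p + q)) := by
    rw [abs_mul, abs_mul, abs_of_nonneg (by positivity : 0 ≤ 2 * p), abs_of_nonneg (by positivity : 0 ≤ p + q)]
    have := mul_le_mul_of_nonneg_left b2 (by positivity : 0 ≤ 2 * p * (p + q))
    linarith
  refine (abs_add_le _ _).trans ((add_le_add b1 b3).trans ?_)
  rw [← mul_add, mul_assoc, mul_comm 4, mul_assoc]
  refine mul_le_mul_of_nonneg_left ?_ (sq_nonneg k)
  have : 1 + p ^ 2 + 2 * p * (p + q) ≤ 4 * ((1 + p ^ 2) * (1 + q ^ 2)) := by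
    nlinarith [sq_nonneg (p - q), sq_nonneg (p * q), sq_nonneg p, sq_nonneg q]
  refine (by linarith : _ ≤ 4 * ((1 + p ^ 2) * (1 + q ^ 2))).trans ?_
  have h1 : (1 + p ^ 2) * (1 + q ^ 2) ≤ (1 + p ^ 2) ^ 2 * (1 + q ^ 2) := by
    apply mul_le_mul_of_nonneg_right _ (by positivity)
    nlinarith [sq_nonneg p, sq_nonneg (p ^ 2)]
  linarith

lemma good_base {n : ℕ} (m u : ℝ) (hm : 0 ≤ m) (i : Fin n) :
    Good (m + 4 * m ^ 2) (fun x => psi (m * (x i - u)))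
      (fun j x => if j = i then m * dpsi (m * (x i - u)) else 0) where
  meas := psi_meas.comp (by fun_prop)
  measD := fun j => by
    by_cases h : j = i
    · simp only [h, if_true]
      exact (dpsi_meas.comp (by fun_prop)).const_mul m
    · simp only [h, if_false]; exact measurable_const
  nonneg := fun x => psi_nonneg _
  le_one := fun x => psi_le_one _
  D_nonpos := fun j x => by
    split_ifs
    · exact mul_nonpos_of_nonneg_of_nonpos hm (dpsi_nonpos _)
    · exact le_rfl
  D_bound := fun j x => by
    split_ifs
    · have := mul_le_mul_of_nonneg_left (dpsi_bound (m * (x i - u))) hm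
      nlinarith [sq_nonneg m]
    · have : 0 ≤ m + 4 * m ^ 2 := by positivity
      linarith
  taylor := fun x h => by
    have t := psi_taylor (m * (x i - u)) (m * h i)
    have e : ∑ j, (if j = i then m * dpsi (m * (x i - u)) else 0) * h j = dpsi (m * (x i - u)) * (m * h i) := by
      simp only [ite_mul, zero_mul, Finset.sum_ite_eq', Finset.mem_univ, if_true]; ring
    rw [e]
    have e2 : m * ((x + h) i - u) = m * (x i - u) + m * h i := by simp; ring
    simp only [e2]
    refine t.trans ?_
    have : (h i) ^ 2 ≤ ‖h‖ ^ 2 := by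
      rw [← sq_abs]; exact pow_le_pow_left₀ (abs_nonneg _) (norm_le_pi_norm h i) 2
    nlinarith [sq_nonneg m, mul_nonneg (sq_nonneg m) (sub_nonneg.2 this), mul_nonneg hm (sq_nonneg ‖h‖)]

lemma good_prod {n : ℕ} (m u : ℝ) (hm : 0 ≤ m) (S : Finset (Fin n)) :
    ∃ C L D, 0 ≤ C ∧ 0 ≤ L ∧ Good C (fun x : Fin n → ℝ => ∏ i ∈ S, psi (m * (x i - u))) D ∧
      ∀ x h : Fin n → ℝ, |(∏ i ∈ S, psi (m * ((x + h) i - u))) - ∏ i ∈ S, psi (m * (x i - u))| ≤ L * ‖h‖ := by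
  classical
  induction S using Finset.induction_on with
  | empty =>
    refine ⟨0, 0, fun _ _ => 0, le_rfl, le_rfl, ?_, by simp⟩
    constructor <;> simp
  | insert i S hi ih =>
    obtain ⟨C, L, D, hC, hL, hG, hlip⟩ := ih
    have hb := good_base m u hm i
    have lipb : ∀ x h : Fin n → ℝ, |psi (m * ((x + h) i - u)) - psi (m * (x i - u))| ≤ m * ‖h‖ := by
      intro x h
      have e2 : m * ((x + h) i - u) = m * (x i - u) + m * h i := by simp; ring
      rw [e2]
      refine (psi_lip _ _).trans ?_
      rw [abs_mul, abs_of_nonneg hm]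
      exact mul_le_mul_of_nonneg_left (norm_le_pi_norm h i) hm
    have hbase : 0 ≤ m + 4 * m ^ 2 := by positivity
    have hmul := Good.mul hbase hC hm hb hG lipb
    simp_rw [Finset.prod_insert hi]
    refine ⟨_, m + L, _, ?_, by positivity, hmul, ?_⟩
    · positivity
    · intro x h
      have a := lipb x h
      have b := hlip x h
      have p1 := psi_nonneg (m * ((x + h) i - u))
      have p2 := psi_le_one (m * ((x + h) i - u))
      have p3 := hG.nonneg x
      have p4 := hG.le_one x
      set a1 := psi (m * ((x + h) i - u))
      set a0 := psi (m * (x i - u))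
      set b1 := ∏ i ∈ S, psi (m * ((x + h) i - u))
      set b0 := ∏ i ∈ S, psi (m * (x i - u))
      have e : a1 * b1 - a0 * b0 = a1 * (b1 - b0) + b0 * (a1 - a0) := by ring
      rw [e]
      refine (abs_add_le _ _).trans ?_
      rw [abs_mul, abs_mul, abs_of_nonneg p1, abs_of_nonneg p3]
      have := mul_le_mul p2 b (abs_nonneg _) zero_le_one
      have := mul_le_mul p4 a (abs_nonneg _) zero_le_one
      linarith

lemma psi_tendsto (x : ℝ) (u : ℝ) :
    Tendsto (fun m : ℕ => psi (m * (x - u))) atTop (𝓝 (if x ≤ u then 1 else 0)) := by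
  split_ifs with h
  · have : ∀ m : ℕ, psi (m * (x - u)) = 1 := by
      intro m
      have : max ((m : ℝ) * (x - u)) 0 = 0 := max_eq_right (mul_nonpos_of_nonneg_of_nonpos (by positivity) (by linarith))
      simp [psi, this]
    simp_rw [this]; exact tendsto_const_nhds
  · have hx : 0 < x - u := by linarith
    have h1 : Tendsto (fun m : ℕ => (m : ℝ) * (x - u)) atTop atTop :=
      tendsto_natCast_atTop_atTop.atTop_mul_const hx
    have h2 : Tendsto psi atTop (𝓝 0) := by
      unfold psi
      simp_rw [one_div]
      apply Tendsto.inv_tendsto_atTop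
      apply tendsto_atTop_add_const_left
      apply (tendsto_pow_atTop (two_ne_zero)).comp
      exact tendsto_atTop_mono (fun x => le_max_left x 0) tendsto_id
    exact h2.comp h1

section
variable {n : ℕ} {μ : Measure (Fin n → ℝ)} [IsProbabilityMeasure μ]

lemma prod_tendsto (u : ℝ) (S : Finset (Fin n)) :
    Tendsto (fun m : ℕ => ∫ y, ∏ i ∈ S, psi (m * (y i - u)) ∂μ) atTop
      (𝓝 (μ.real {y | ∀ i ∈ S, y i ≤ u})) := by
  have hms : MeasurableSet {y : Fin n → ℝ | ∀ i ∈ S, y i ≤ u} := by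
    have : {y : Fin n → ℝ | ∀ i ∈ S, y i ≤ u} = ⋂ i ∈ S, {y | y i ≤ u} := by ext; simp
    rw [this]
    exact Finset.measurableSet_biInter _ fun i _ => measurableSet_le (measurable_pi_apply i) measurable_const
  rw [← integral_indicator_one hms]
  refine tendsto_integral_of_dominated_convergence (fun _ => 1) ?_ (integrable_const _) ?_ ?_
  · intro m
    refine Measurable.aestronglyMeasurable ?_
    refine Finset.measurable_prod _ fun i _ => psi_meas.comp (by fun_prop)
  · intro m
    refine Eventually.of_forall fun y => ?_
    rw [Real.norm_of_nonneg (Finset.prod_nonneg fun i _ => psi_nonneg _)]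
    exact Finset.prod_le_one (fun i _ => psi_nonneg _) fun i _ => psi_le_one _
  · refine Eventually.of_forall fun y => ?_
    have := tendsto_finsetProd S fun i _ => psi_tendsto (y i) u
    convert this using 2
    classical
    rw [Finset.prod_ite_zero]
    simp [indicator_apply]

lemma finite_assoc (hmom : ∀ k : ℕ, k ≤ 4 → Integrable (fun y : Fin n → ℝ => ‖y‖ ^ k) μ)
    (hmean : ∀ i, ∫ y, y i ∂μ = 0) (hcov : ∀ i j, 0 ≤ ∫ y, y i * y j ∂μ)
    (hstab : ∀ a b : ℝ, (μ.map (a • ·)) ∗ (μ.map (b • ·)) = μ.map (√(a ^ 2 + b ^ 2) • ·))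
    (u : ℝ) (S T : Finset (Fin n)) (hST : Disjoint S T) :
    μ.real {y | ∀ i ∈ S, y i ≤ u} * μ.real {y | ∀ i ∈ T, y i ≤ u}
      ≤ μ.real {y | ∀ i ∈ S ∪ T, y i ≤ u} := by
  refine le_of_tendsto_of_tendsto' ((prod_tendsto u S).mul (prod_tendsto u T)) (prod_tendsto u (S ∪ T)) ?_
  intro m
  obtain ⟨C, L, D, hC, hL, hG, -⟩ := good_prod m u (Nat.cast_nonneg m) S
  obtain ⟨C', L', D', hC', hL', hG', -⟩ := good_prod m u (Nat.cast_nonneg m) T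
  have := assoc (μ := μ) (le_max_of_le_left hC : 0 ≤ max C C') hmom hmean hcov hstab
    (hG.mono (le_max_left _ _)) (hG'.mono (le_max_right _ _))
  simp_rw [Finset.prod_union hST]
  exact this

variable {R : Fin n → Fin n → ℝ}

lemma gauss_char {μ : Measure (Fin n → ℝ)} (hμ : ∀ c : Fin n → ℝ, μ.map (fun y => ∑ i, c i * y i) =
      gaussianReal 0 (Real.toNNReal (∑ i, ∑ j, c i * c j * R i j))) (L : StrongDual ℝ (Fin n → ℝ)) :
    charFunDual μ L = Complex.exp (-((max (∑ i, ∑ j, L (Pi.single i 1) * L (Pi.single j 1) * R i j) 0 : ℝ) : ℂ) / 2) := by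
  have hL : (L : (Fin n → ℝ) → ℝ) = fun y => ∑ i, L (Pi.single i 1) * y i := by
    ext y
    conv_lhs => rw [pi_eq_sum_univ' y]
    simp [map_sum, mul_comm]
  rw [charFunDual_eq_charFun_map_one]
  conv_lhs => rw [hL]
  rw [hμ, charFun_gaussianReal]
  simp [Real.coe_toNNReal', neg_div]

lemma gauss_stab (hμ : ∀ c : Fin n → ℝ, μ.map (fun y => ∑ i, c i * y i) =
      gaussianReal 0 (Real.toNNReal (∑ i, ∑ j, c i * c j * R i j))) (a b : ℝ) :
    (μ.map (a • ·)) ∗ (μ.map (b • ·)) = μ.map (√(a ^ 2 + b ^ 2) • ·) := by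
  have : ∀ a : ℝ, IsProbabilityMeasure (μ.map (a • ·)) := fun a =>
    Measure.isProbabilityMeasure_map (by fun_prop)
  apply Measure.ext_of_charFunDual
  ext L
  have key : ∀ a : ℝ, charFunDual (μ.map (a • ·)) L = Complex.exp (-((a ^ 2 * max (∑ i, ∑ j, L (Pi.single i 1) * L (Pi.single j 1) * R i j) 0 : ℝ) : ℂ) / 2) := by
    intro a
    have h1 : (fun x : Fin n → ℝ => a • x) = ((a • ContinuousLinearMap.id ℝ (Fin n → ℝ) : (Fin n → ℝ) →L[ℝ] (Fin n → ℝ)) : (Fin n → ℝ) → (Fin n → ℝ)) := by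
      ext; simp
    rw [h1, charFunDual_map, gauss_char hμ]
    congr 4
    rw [mul_max_of_nonneg _ _ (sq_nonneg a), mul_zero]
    congr 1
    rw [Finset.mul_sum]
    refine Finset.sum_congr rfl fun i _ => ?_
    rw [Finset.mul_sum]
    refine Finset.sum_congr rfl fun j _ => ?_
    simp; ring
  rw [charFunDual_conv, key, key, key, ← Complex.exp_add, Real.sq_sqrt (by positivity)]
  congr 1
  push_cast; ring

lemma gauss_unique {μ' : Measure (Fin n → ℝ)} [IsProbabilityMeasure μ']
    (hμ : ∀ c : Fin n → ℝ, μ.map (fun y => ∑ i, c i * y i) =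
      gaussianReal 0 (Real.toNNReal (∑ i, ∑ j, c i * c j * R i j)))
    (hμ' : ∀ c : Fin n → ℝ, μ'.map (fun y => ∑ i, c i * y i) =
      gaussianReal 0 (Real.toNNReal (∑ i, ∑ j, c i * c j * R i j))) : μ = μ' := by
  apply Measure.ext_of_charFunDual
  ext L
  rw [gauss_char hμ, gauss_char hμ']

lemma gauss_coord {μ : Measure (Fin n → ℝ)} (hμ : ∀ c : Fin n → ℝ, μ.map (fun y => ∑ i, c i * y i) =
      gaussianReal 0 (Real.toNNReal (∑ i, ∑ j, c i * c j * R i j))) (i : Fin n) :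
    μ.map (fun y => y i) = gaussianReal 0 (Real.toNNReal (R i i)) := by
  have := hμ (Pi.single i 1)
  simpa [Pi.single_apply] using this

lemma gauss_memLp (hμ : ∀ c : Fin n → ℝ, μ.map (fun y => ∑ i, c i * y i) =
      gaussianReal 0 (Real.toNNReal (∑ i, ∑ j, c i * c j * R i j))) (i : Fin n) (p : NNReal) :
    MemLp (fun y : Fin n → ℝ => y i) p μ := by
  have h := memLp_id_gaussianReal (μ := 0) (v := Real.toNNReal (R i i)) p
  have hm : AEMeasurable (fun y : Fin n → ℝ => y i) μ := (measurable_pi_apply i).aemeasurable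
  rw [← gauss_coord hμ i, memLp_map_measure_iff (by fun_prop) hm] at h
  exact h

lemma gauss_mom (hμ : ∀ c : Fin n → ℝ, μ.map (fun y => ∑ i, c i * y i) =
      gaussianReal 0 (Real.toNNReal (∑ i, ∑ j, c i * c j * R i j))) (k : ℕ) :
    Integrable (fun y : Fin n → ℝ => ‖y‖ ^ k) μ := by
  have : MemLp (fun y : Fin n → ℝ => y) ((k : NNReal)) μ := memLp_pi_iff.2 fun i => gauss_memLp hμ i k
  exact MemLp.integrable_norm_pow' (by simpa using this)

lemma gauss_mean (hμ : ∀ c : Fin n → ℝ, μ.map (fun y => ∑ i, c i * y i) =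
      gaussianReal 0 (Real.toNNReal (∑ i, ∑ j, c i * c j * R i j))) (i : Fin n) :
    ∫ y, y i ∂μ = 0 := by
  have h := integral_id_gaussianReal (μ := 0) (v := Real.toNNReal (R i i))
  rw [← gauss_coord hμ i, integral_map (measurable_pi_apply i).aemeasurable (by fun_prop)] at h
  exact h

lemma gauss_sq (v : NNReal) : ∫ x, x ^ 2 ∂(gaussianReal 0 v) = v := by
  have h := variance_id_gaussianReal (μ := 0) (v := v)
  rw [variance_of_integral_eq_zero (by fun_prop) (by simp)] at h
  simpa using h

lemma gauss_cov (hR : ∀ i j, 0 ≤ R i j) (hμ : ∀ c : Fin n → ℝ, μ.map (fun y => ∑ i, c i * y i) =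
      gaussianReal 0 (Real.toNNReal (∑ i, ∑ j, c i * c j * R i j))) (i j : Fin n) :
    0 ≤ ∫ y, y i * y j ∂μ := by
  have sqi : ∀ i, ∫ y, (y i) ^ 2 ∂μ = R i i := fun i => by
    have h := gauss_sq (Real.toNNReal (R i i))
    rw [← gauss_coord hμ i, integral_map (measurable_pi_apply i).aemeasurable (by fun_prop), Real.coe_toNNReal _ (hR i i)] at h
    exact h
  have hs := hμ (Pi.single i 1 + Pi.single j 1)
  have e1 : (fun y : Fin n → ℝ => ∑ k, (Pi.single i 1 + Pi.single j 1 : Fin n → ℝ) k * y k) = fun y => y i + y j := by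
    ext y; simp [add_mul, Finset.sum_add_distrib, Pi.single_apply]
  have e2 : ∑ k, ∑ l, (Pi.single i 1 + Pi.single j 1 : Fin n → ℝ) k * (Pi.single i 1 + Pi.single j 1 : Fin n → ℝ) l * R k l
      = R i i + R i j + R j i + R j j := by
    simp [add_mul, mul_add, Finset.sum_add_distrib, Pi.single_apply]; ring
  rw [e1, e2] at hs
  have h := gauss_sq (Real.toNNReal (R i i + R i j + R j i + R j j))
  rw [← hs, integral_map (by fun_prop) (by fun_prop), Real.coe_toNNReal _
    (add_nonneg (add_nonneg (add_nonneg (hR _ _) (hR _ _)) (hR _ _)) (hR _ _))] at h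
  have m2 : ∀ i, MemLp (fun y : Fin n → ℝ => y i) 2 μ := fun i => by simpa using gauss_memLp hμ i 2
  have i2 : ∀ i, Integrable (fun y : Fin n → ℝ => (y i) ^ 2) μ := fun i => (m2 i).integrable_sq
  have ij : Integrable (fun y : Fin n → ℝ => y i * y j) μ := (m2 i).integrable_mul (m2 j)
  have i3 : Integrable (fun y : Fin n → ℝ => (y i) ^ 2 + 2 * (y i * y j)) μ := (i2 i).add (ij.const_mul 2)
  have e3 : ∫ y : Fin n → ℝ, (y i + y j) ^ 2 ∂μ = R i i + 2 * (∫ y, y i * y j ∂μ) + R j j := by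
    rw [← sqi i, ← sqi j, ← integral_const_mul, ← integral_add (i2 i) (ij.const_mul 2),
      ← integral_add i3 (i2 j)]
    congr 1; ext y; ring
  rw [e3] at h
  linarith [hR i j, hR j i]
end


section
variable {Ω : Type*} [MeasurableSpace Ω] {P : Measure Ω} [IsProbabilityMeasure P]
    {X : ℝ → Ω → ℝ} {r : ℝ → ℝ}

lemma X_aemeas (hGauss : ∀ (n : ℕ) (c : Fin n → ℝ) (t : Fin n → ℝ), (∀ i, 0 ≤ t i) →
      Measure.map (fun ω => ∑ i, c i * X (t i) ω) P
        = gaussianReal 0 (Real.toNNReal (∑ i, ∑ j, c i * c j * r (|t i - t j|))))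
    {s : ℝ} (hs : 0 ≤ s) : AEMeasurable (X s) P := by
  have h := hGauss 1 (fun _ => 1) (fun _ => s) (fun _ => hs)
  simp only [Finset.univ_unique, Finset.sum_singleton, one_mul] at h
  apply AEMeasurable.of_map_ne_zero
  rw [h]
  exact IsProbabilityMeasure.ne_zero _

lemma vec_aemeas (hGauss : ∀ (n : ℕ) (c : Fin n → ℝ) (t : Fin n → ℝ), (∀ i, 0 ≤ t i) →
      Measure.map (fun ω => ∑ i, c i * X (t i) ω) P
        = gaussianReal 0 (Real.toNNReal (∑ i, ∑ j, c i * c j * r (|t i - t j|))))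
    {n : ℕ} (t : Fin n → ℝ) (ht : ∀ i, 0 ≤ t i) : AEMeasurable (fun ω i => X (t i) ω) P :=
  aemeasurable_pi_iff.2 fun i => X_aemeas hGauss (ht i)

lemma vec_gauss (hGauss : ∀ (n : ℕ) (c : Fin n → ℝ) (t : Fin n → ℝ), (∀ i, 0 ≤ t i) →
      Measure.map (fun ω => ∑ i, c i * X (t i) ω) P
        = gaussianReal 0 (Real.toNNReal (∑ i, ∑ j, c i * c j * r (|t i - t j|))))
    {n : ℕ} (t : Fin n → ℝ) (ht : ∀ i, 0 ≤ t i) (c : Fin n → ℝ) :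
    (P.map (fun ω i => X (t i) ω)).map (fun y => ∑ i, c i * y i) =
      gaussianReal 0 (Real.toNNReal (∑ i, ∑ j, c i * c j * r (|t i - t j|))) := by
  rw [AEMeasurable.map_map_of_aemeasurable (Measurable.aemeasurable (by fun_prop)) (vec_aemeas hGauss t ht)]
  exact hGauss n c t ht

lemma vec_real (hGauss : ∀ (n : ℕ) (c : Fin n → ℝ) (t : Fin n → ℝ), (∀ i, 0 ≤ t i) →
      Measure.map (fun ω => ∑ i, c i * X (t i) ω) P
        = gaussianReal 0 (Real.toNNReal (∑ i, ∑ j, c i * c j * r (|t i - t j|))))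
    {n : ℕ} (t : Fin n → ℝ) (ht : ∀ i, 0 ≤ t i) (u : ℝ) (S : Finset (Fin n)) :
    (P.map (fun ω i => X (t i) ω)).real {y | ∀ i ∈ S, y i ≤ u} = P.real {ω | ∀ i ∈ S, X (t i) ω ≤ u} := by
  have hms : MeasurableSet {y : Fin n → ℝ | ∀ i ∈ S, y i ≤ u} := by
    have : {y : Fin n → ℝ | ∀ i ∈ S, y i ≤ u} = ⋂ i ∈ S, {y | y i ≤ u} := by ext; simp
    rw [this]
    exact Finset.measurableSet_biInter _ fun i _ => measurableSet_le (measurable_pi_apply i) measurable_const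
  rw [measureReal_def, Measure.map_apply_of_aemeasurable (vec_aemeas hGauss t ht) hms]
  rfl

lemma slepian_fin (hGauss : ∀ (n : ℕ) (c : Fin n → ℝ) (t : Fin n → ℝ), (∀ i, 0 ≤ t i) →
      Measure.map (fun ω => ∑ i, c i * X (t i) ω) P
        = gaussianReal 0 (Real.toNNReal (∑ i, ∑ j, c i * c j * r (|t i - t j|))))
    (hrpos : ∀ t : ℝ, 0 ≤ t → 0 ≤ r t)
    {n : ℕ} (t : Fin n → ℝ) (ht : ∀ i, 0 ≤ t i) (u : ℝ) (S T : Finset (Fin n)) (hST : Disjoint S T) :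
    P.real {ω | ∀ i ∈ S, X (t i) ω ≤ u} * P.real {ω | ∀ i ∈ T, X (t i) ω ≤ u}
      ≤ P.real {ω | ∀ i ∈ S ∪ T, X (t i) ω ≤ u} := by
  have : IsProbabilityMeasure (P.map (fun ω i => X (t i) ω)) :=
    Measure.isProbabilityMeasure_map (vec_aemeas hGauss t ht)
  have hμ := vec_gauss hGauss t ht
  have hμ' : ∀ c : Fin n → ℝ, (P.map (fun ω i => X (t i) ω)).map (fun y => ∑ i, c i * y i) =
      gaussianReal 0 (Real.toNNReal (∑ i, ∑ j, c i * c j * (fun i j => r (|t i - t j|)) i j)) := hμ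
  rw [← vec_real hGauss t ht, ← vec_real hGauss t ht, ← vec_real hGauss t ht]
  exact finite_assoc (fun k _ => gauss_mom hμ' k) (gauss_mean hμ')
    (gauss_cov (fun i j => hrpos _ (abs_nonneg _)) hμ') (gauss_stab hμ') u S T hST

lemma stat_fin (hGauss : ∀ (n : ℕ) (c : Fin n → ℝ) (t : Fin n → ℝ), (∀ i, 0 ≤ t i) →
      Measure.map (fun ω => ∑ i, c i * X (t i) ω) P
        = gaussianReal 0 (Real.toNNReal (∑ i, ∑ j, c i * c j * r (|t i - t j|))))
    {n : ℕ} (t : Fin n → ℝ) (ht : ∀ i, 0 ≤ t i) (a : ℝ) (ha : 0 ≤ a) (u : ℝ) :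
    P.real {ω | ∀ i, X (t i) ω ≤ u} = P.real {ω | ∀ i, X (a + t i) ω ≤ u} := by
  have ht' : ∀ i, 0 ≤ a + t i := fun i => add_nonneg ha (ht i)
  have : IsProbabilityMeasure (P.map (fun ω i => X (t i) ω)) :=
    Measure.isProbabilityMeasure_map (vec_aemeas hGauss t ht)
  have : IsProbabilityMeasure (P.map (fun ω i => X (a + t i) ω)) :=
    Measure.isProbabilityMeasure_map (vec_aemeas hGauss (fun i => a + t i) ht')
  have h1 : ∀ c : Fin n → ℝ, (P.map (fun ω i => X (t i) ω)).map (fun y => ∑ i, c i * y i) =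
      gaussianReal 0 (Real.toNNReal (∑ i, ∑ j, c i * c j * (fun i j => r (|t i - t j|)) i j)) :=
    vec_gauss hGauss t ht
  have h2 : ∀ c : Fin n → ℝ, (P.map (fun ω i => X (a + t i) ω)).map (fun y => ∑ i, c i * y i) =
      gaussianReal 0 (Real.toNNReal (∑ i, ∑ j, c i * c j * (fun i j => r (|t i - t j|)) i j)) := by
    intro c
    have := vec_gauss hGauss (fun i => a + t i) ht' c
    simpa only [add_sub_add_left_eq_sub] using this
  have e := gauss_unique h1 h2
  have e1 := vec_real hGauss t ht u Finset.univ
  have e2 := vec_real hGauss (fun i => a + t i) ht' u Finset.univ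
  rw [e, e2] at e1
  simpa using e1.symm

lemma tend_inter (A : ℕ → Set Ω) (hA : ∀ i, NullMeasurableSet (A i) P) :
    Tendsto (fun n : ℕ => P.real {ω | ∀ i : Fin n, ω ∈ A i}) atTop (𝓝 (P.real {ω | ∀ i, ω ∈ A i})) := by
  have e : {ω | ∀ i, ω ∈ A i} = ⋂ n : ℕ, {ω | ∀ i : Fin n, ω ∈ A i} := by
    ext ω
    simp only [mem_ofPred_eq, mem_iInter]
    exact ⟨fun h n i => h i, fun h i => h (i + 1) ⟨i, by omega⟩⟩
  rw [e]
  refine (ENNReal.tendsto_toReal (measure_ne_top P _)).comp (tendsto_measure_iInter_atTop ?_ ?_ ⟨0, measure_ne_top P _⟩)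
  · intro n
    have : {ω | ∀ i : Fin n, ω ∈ A i} = ⋂ i : Fin n, A i := by ext; simp
    rw [this]
    exact NullMeasurableSet.iInter fun i => hA i
  · intro m n hmn ω hω i
    exact hω ⟨i, by omega⟩

lemma slepian_seq (hGauss : ∀ (n : ℕ) (c : Fin n → ℝ) (t : Fin n → ℝ), (∀ i, 0 ≤ t i) →
      Measure.map (fun ω => ∑ i, c i * X (t i) ω) P
        = gaussianReal 0 (Real.toNNReal (∑ i, ∑ j, c i * c j * r (|t i - t j|))))
    (hrpos : ∀ t : ℝ, 0 ≤ t → 0 ≤ r t) (u : ℝ)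
    (d e : ℕ → ℝ) (hd : ∀ i, 0 ≤ d i) (he : ∀ i, 0 ≤ e i) :
    P.real {ω | ∀ i, X (d i) ω ≤ u} * P.real {ω | ∀ i, X (e i) ω ≤ u}
      ≤ P.real {ω | ∀ i, X (d i) ω ≤ u ∧ X (e i) ω ≤ u} := by
  have nm : ∀ s, 0 ≤ s → NullMeasurableSet {ω | X s ω ≤ u} P := fun s hs =>
    nullMeasurableSet_le (X_aemeas hGauss hs) aemeasurable_const
  have t1 := tend_inter (P := P) (fun i => {ω | X (d i) ω ≤ u}) fun i => nm _ (hd i)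
  have t2 := tend_inter (P := P) (fun i => {ω | X (e i) ω ≤ u}) fun i => nm _ (he i)
  have t3 := tend_inter (P := P) (fun i => {ω | X (d i) ω ≤ u} ∩ {ω | X (e i) ω ≤ u})
    fun i => (nm _ (hd i)).inter (nm _ (he i))
  refine le_of_tendsto_of_tendsto' (t1.mul t2) t3 fun n => ?_
  set t : Fin (n + n) → ℝ := Fin.append (fun i : Fin n => d i) (fun i : Fin n => e i) with ht
  have tl : ∀ j : Fin n, t (Fin.castAdd n j) = d j := fun j => by rw [ht, Fin.append_left]
  have tr : ∀ j : Fin n, t (Fin.natAdd n j) = e j := fun j => by rw [ht, Fin.append_right]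
  have el : ∀ ω, (∀ i ∈ Finset.univ.map (Fin.castAddEmb n : Fin n ↪ Fin (n + n)), X (t i) ω ≤ u)
      ↔ ∀ i : Fin n, X (d i) ω ≤ u := by
    intro ω
    rw [Finset.forall_mem_map]
    exact ⟨fun h i => tl i ▸ h i (Finset.mem_univ i), fun h i _ => (tl i).symm ▸ h i⟩
  have er : ∀ ω, (∀ i ∈ Finset.univ.map (Fin.natAddEmb n : Fin n ↪ Fin (n + n)), X (t i) ω ≤ u)
      ↔ ∀ i : Fin n, X (e i) ω ≤ u := by
    intro ω
    rw [Finset.forall_mem_map]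
    exact ⟨fun h i => tr i ▸ h i (Finset.mem_univ i), fun h i _ => (tr i).symm ▸ h i⟩
  have ht0 : ∀ i, 0 ≤ t i := by
    intro i
    refine Fin.addCases (fun j => ?_) (fun j => ?_) i
    · rw [tl]; exact hd _
    · rw [tr]; exact he _
  have hdis : Disjoint (Finset.univ.map (Fin.castAddEmb n : Fin n ↪ Fin (n + n)))
      (Finset.univ.map (Fin.natAddEmb n : Fin n ↪ Fin (n + n))) := by
    rw [Finset.disjoint_left]
    simp only [Finset.mem_map, Finset.mem_univ, true_and]
    rintro _ ⟨i, rfl⟩ ⟨j, hj⟩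
    have := congrArg Fin.val hj
    simp at this
    omega
  have := slepian_fin hGauss hrpos t ht0 u _ _ hdis
  simp only [Finset.mem_union, or_imp, forall_and, el, er] at this
  refine this.trans (le_of_eq ?_)
  congr 1
  ext ω
  exact forall_and.symm

lemma stat_seq (hGauss : ∀ (n : ℕ) (c : Fin n → ℝ) (t : Fin n → ℝ), (∀ i, 0 ≤ t i) →
      Measure.map (fun ω => ∑ i, c i * X (t i) ω) P
        = gaussianReal 0 (Real.toNNReal (∑ i, ∑ j, c i * c j * r (|t i - t j|))))
    (u : ℝ) (d : ℕ → ℝ) (hd : ∀ i, 0 ≤ d i) (a : ℝ) (ha : 0 ≤ a) :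
    P.real {ω | ∀ i, X (d i) ω ≤ u} = P.real {ω | ∀ i, X (a + d i) ω ≤ u} := by
  have nm : ∀ s, 0 ≤ s → NullMeasurableSet {ω | X s ω ≤ u} P := fun s hs =>
    nullMeasurableSet_le (X_aemeas hGauss hs) aemeasurable_const
  have t1 := tend_inter (P := P) (fun i => {ω | X (d i) ω ≤ u}) fun i => nm _ (hd i)
  have t2 := tend_inter (P := P) (fun i => {ω | X (a + d i) ω ≤ u}) fun i => nm _ (add_nonneg ha (hd i))
  refine tendsto_nhds_unique t1 (t2.congr fun n => ?_)
  exact (stat_fin hGauss (fun i : Fin n => d i) (fun i => hd i) a ha u).symm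

lemma dense_event {f : ℝ → ℝ} (hf : ContinuousOn f (Ici 0)) {a b u : ℝ} (ha : 0 ≤ a) (d : ℕ → ℝ)
    (hd : ∀ i, d i ∈ Icc a b) (hcl : Icc a b ⊆ closure (range d)) :
    (∀ s ∈ Icc a b, f s ≤ u) ↔ ∀ i, f (d i) ≤ u := by
  refine ⟨fun h i => h _ (hd i), fun h s hs => ?_⟩
  have hc : IsClosed (Icc a b ∩ f ⁻¹' Iic u) :=
    (hf.mono fun x hx => ha.trans hx.1).preimage_isClosed_of_isClosed isClosed_Icc isClosed_Iic
  have : closure (range d) ⊆ Icc a b ∩ f ⁻¹' Iic u := by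
    apply closure_minimal _ hc
    rintro _ ⟨i, rfl⟩
    exact ⟨hd i, h i⟩
  exact (this (hcl hs)).2

lemma exists_dense (b : ℝ) (hb : 0 ≤ b) : ∃ d : ℕ → ℝ, (∀ i, d i ∈ Icc 0 b) ∧ Icc 0 b ⊆ closure (range d) := by
  have : Nonempty (Icc 0 b) := ⟨⟨0, le_rfl, hb⟩⟩
  refine ⟨fun i => TopologicalSpace.denseSeq (Icc 0 b) i, fun i => Subtype.coe_prop _, ?_⟩
  intro x hx
  have h := (TopologicalSpace.denseRange_denseSeq (Icc 0 b)) ⟨x, hx⟩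
  have := (closure_subtype.1 h)
  rwa [← range_comp] at this

lemma sup_event {f : ℝ → ℝ} (hf : ContinuousOn f (Ici 0)) {b u : ℝ} (hb : 0 ≤ b) :
    sSup (f '' Icc 0 b) ≤ u ↔ ∀ s ∈ Icc 0 b, f s ≤ u := by
  have hbd : BddAbove (f '' Icc 0 b) :=
    (isCompact_Icc.image_of_continuousOn (hf.mono fun x hx => hx.1)).bddAbove
  rw [csSup_le_iff hbd ((nonempty_Icc.2 hb).image f)]
  exact forall_mem_image

lemma add_one_step (hGauss : ∀ (n : ℕ) (c : Fin n → ℝ) (t : Fin n → ℝ), (∀ i, 0 ≤ t i) →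
      Measure.map (fun ω => ∑ i, c i * X (t i) ω) P
        = gaussianReal 0 (Real.toNNReal (∑ i, ∑ j, c i * c j * r (|t i - t j|))))
    (hcont : ∀ᵐ ω ∂P, ContinuousOn (fun t => X t ω) (Ici 0))
    (hrpos : ∀ t : ℝ, 0 ≤ t → 0 ≤ r t) (u a : ℝ) (ha : 0 ≤ a) :
    P.real {ω | ∀ s ∈ Icc 0 a, X s ω ≤ u} * P.real {ω | ∀ s ∈ Icc (0:ℝ) 1, X s ω ≤ u}
      ≤ P.real {ω | ∀ s ∈ Icc 0 (a + 1), X s ω ≤ u} := by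
  obtain ⟨d, hd, hdc⟩ := exists_dense a ha
  obtain ⟨e, he, hec⟩ := exists_dense 1 zero_le_one
  have h1 : P.real {ω | ∀ s ∈ Icc 0 a, X s ω ≤ u} = P.real {ω | ∀ i, X (d i) ω ≤ u} := by
    apply measureReal_congr
    filter_upwards [hcont] with ω hω
    exact propext (dense_event hω le_rfl d hd hdc)
  have h2 : P.real {ω | ∀ s ∈ Icc (0:ℝ) 1, X s ω ≤ u} = P.real {ω | ∀ i, X (e i) ω ≤ u} := by
    apply measureReal_congr
    filter_upwards [hcont] with ω hω
    exact propext (dense_event hω le_rfl e he hec)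
  have h3 : P.real {ω | ∀ s ∈ Icc 0 (a + 1), X s ω ≤ u} =
      P.real {ω | ∀ i, X (d i) ω ≤ u ∧ X (a + e i) ω ≤ u} := by
    apply measureReal_congr
    filter_upwards [hcont] with ω hω
    apply propext
    change (∀ s ∈ Icc 0 (a + 1), X s ω ≤ u) ↔ ∀ i, X (d i) ω ≤ u ∧ X (a + e i) ω ≤ u
    rw [forall_and, ← dense_event hω le_rfl d hd hdc,
      ← dense_event hω (b := a + 1) ha (fun i => a + e i)
        (fun i => ⟨by linarith [(he i).1], by linarith [(he i).2]⟩) ?_]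
    · constructor
      · intro h
        exact ⟨fun s hs => h s ⟨hs.1, by linarith [hs.2]⟩, fun s hs => h s ⟨ha.trans hs.1, hs.2⟩⟩
      · rintro ⟨h, h'⟩ s hs
        rcases le_total s a with hsa | hsa
        · exact h s ⟨hs.1, hsa⟩
        · exact h' s ⟨hsa, hs.2⟩
    · intro s hs
      have h := hec (⟨by linarith [hs.1], by linarith [hs.2]⟩ : s - a ∈ Icc (0:ℝ) 1)
      have hc : Continuous fun x : ℝ => a + x := by fun_prop
      have := image_closure_subset_closure_image hc (mem_image_of_mem _ h)
      rw [← range_comp] at this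
      simpa [Function.comp_def] using this
  rw [h1, h2, h3, stat_seq hGauss u e (fun i => (he i).1) a ha]
  exact slepian_seq hGauss hrpos u d (fun i => a + e i) (fun i => (hd i).1) fun i => add_nonneg ha (he i).1
end

/-- **Lower bound in Lemma 4.3 (via Slepian's inequality).** For a centered stationary
Gaussian process with nonnegative covariance function, for every `u` and `t > 0`,
`P(sup_{s∈[0,t]} X(s) ≤ u) ≥ (P(sup_{s∈[0,1]} X(s) ≤ u))^{⌊t⌋+1}`. -/
theorem slepian_lower_bound
    {Ω : Type*} [MeasurableSpace Ω] (P : Measure Ω) [IsProbabilityMeasure P]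
    (X : ℝ → Ω → ℝ) (r : ℝ → ℝ) (C α : ℝ)
    (hα : 0 < α) (hα2 : α ≤ 2) (hC : 0 < C)
    -- centered stationary Gaussian process with covariance function r
    (hGauss : ∀ (n : ℕ) (c : Fin n → ℝ) (t : Fin n → ℝ), (∀ i, 0 ≤ t i) →
      Measure.map (fun ω => ∑ i, c i * X (t i) ω) P
        = gaussianReal 0 (Real.toNNReal (∑ i, ∑ j, c i * c j * r (|t i - t j|))))
    -- a.s. continuous sample paths
    (hcont : ∀ᵐ ω ∂P, ContinuousOn (fun t => X t ω) (Ici 0))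
    (hrpos : ∀ t : ℝ, 0 ≤ t → 0 ≤ r t)
    :
    ∀ (u : ℝ) (t : ℝ), 0 < t →
      ((P {ω | sSup ((fun s => X s ω) '' Icc 0 (1:ℝ)) ≤ u}).toReal) ^ (⌊t⌋₊ + 1)
        ≤ (P {ω | sSup ((fun s => X s ω) '' Icc 0 t) ≤ u}).toReal := by
  intro u t ht
  have hsup : ∀ b : ℝ, 0 ≤ b → (P {ω | sSup ((fun s => X s ω) '' Icc 0 b) ≤ u}).toReal
      = P.real {ω | ∀ s ∈ Icc 0 b, X s ω ≤ u} := by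
    intro b hb
    apply measureReal_congr
    filter_upwards [hcont] with ω hω
    exact propext (sup_event hω hb)
  rw [hsup 1 zero_le_one, hsup t ht.le]
  have hind : ∀ k : ℕ, P.real {ω | ∀ s ∈ Icc (0:ℝ) 1, X s ω ≤ u} ^ (k + 1)
      ≤ P.real {ω | ∀ s ∈ Icc (0:ℝ) (k + 1), X s ω ≤ u} := by
    intro k
    induction k with
    | zero => simp
    | succ k ih =>
      rw [pow_succ]
      refine (mul_le_mul_of_nonneg_right ih measureReal_nonneg).trans ?_
      have := add_one_step hGauss hcont hrpos u (k + 1) (by positivity)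
      push_cast
      exact this
  refine (hind ⌊t⌋₊).trans ?_
  refine measureReal_mono ?_
  intro ω hω s hs
  exact hω s ⟨hs.1, hs.2.trans (Nat.lt_floor_add_one t).le⟩
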